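/- For every λ ∈ L₀^# the Dirichlet coefficients are multiplicative: if γ, γ' ∈ ℕ are coprime positive integers, then a(λ, γγ') = a(λ,γ)·a(λ,γ'). -/

import Mathlib

open Matrix Complex

namespace OEis

/-- Extension of an even Gram matrix by a hyperbolic plane:
`[[0,0,1],[0,A,0],[1,0,0]]`. -/
def hyp {m : ℕ} (A : Matrix (Fin m) (Fin m) ℤ) :
    Matrix (Fin (m + 2)) (Fin (m + 2)) ℤ := fun i j =>
  if hi0 : (i : ℕ) = 0 then (if (j : ℕ) = m + 1 then 1 else 0)
  else if him : (i : ℕ) = m + 1 then (if (j : ℕ) = 0 then 1 else 0)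
  else if hj0 : (j : ℕ) = 0 then 0
  else if hjm : (j : ℕ) = m + 1 then 0
  else A ⟨(i : ℕ) - 1, by have := i.isLt; omega⟩ ⟨(j : ℕ) - 1, by have := j.isLt; omega⟩

variable (n : ℕ) (S : Matrix (Fin n) (Fin n) ℤ)

/-- `S₀ = [[0,0,1],[0,-S,0],[1,0,0]]`. -/
def MatS0 : Matrix (Fin (n + 2)) (Fin (n + 2)) ℤ := hyp (-S)

/-- `S₁ = [[0,0,1],[0,S₀,0],[1,0,0]]`. -/
def MatS1 : Matrix (Fin (n + 4)) (Fin (n + 4)) ℤ := hyp (MatS0 n S)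

/-- Bilinear form `uᵀ A v` over a field `K`. -/
def bilin {m : ℕ} (K : Type) [Field K] (A : Matrix (Fin m) (Fin m) ℤ)
    (u v : Fin m → K) : K :=
  u ⬝ᵥ (A.map (Int.cast : ℤ → K)).mulVec v

/-- Quadratic form `Q_A(v) = vᵀAv/2` over a field `K`. -/
def quadF {m : ℕ} (K : Type) [Field K] (A : Matrix (Fin m) (Fin m) ℤ)
    (v : Fin m → K) : K := bilin K A v v / 2

/-- First component of a vector. -/
def vfirst {m : ℕ} {K : Type} (g : Fin (m + 2) → K) : K := g ⟨0, by omega⟩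

/-- Last component of a vector. -/
def vlast {m : ℕ} {K : Type} (g : Fin (m + 2) → K) : K := g ⟨m + 1, by omega⟩

/-- Middle components of a vector. -/
def vmid {m : ℕ} {K : Type} (g : Fin (m + 2) → K) : Fin m → K :=
  fun i => g ⟨(i : ℕ) + 1, by have := i.isLt; omega⟩

/-- gcd of the entries of a rational vector (via numerators). -/
def ratGcd {m : ℕ} (v : Fin m → ℚ) : ℕ :=
  Finset.gcd Finset.univ fun i => (v i).num.natAbs

/-- `v` has integral entries. -/
def inLat {m : ℕ} (v : Fin m → ℚ) : Prop := ∀ i, ∃ z : ℤ, v i = (z : ℚ)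

/-- `g ∈ ℤ^m + c`. -/
def inLatShift {m : ℕ} (c g : Fin m → ℚ) : Prop := ∀ i, ∃ z : ℤ, g i - c i = (z : ℚ)

/-- Membership in the dual lattice `A⁻¹ℤ^m`, i.e. `Av` is integral. -/
def inDual {m : ℕ} (A : Matrix (Fin m) (Fin m) ℤ) (v : Fin m → ℚ) : Prop :=
  ∀ i, ∃ z : ℤ, ((A.map (Int.cast : ℤ → ℚ)).mulVec v) i = (z : ℚ)

/-- The positive cone `P_S`. -/
def PosCone : Set (Fin (n + 2) → ℝ) :=
  {y | 0 < quadF ℝ (MatS0 n S) y ∧ 0 < y ⟨0, by omega⟩}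

/-- The tube domain `H_S`. -/
def HS : Set (Fin (n + 2) → ℂ) :=
  {z | (fun i => (z i).im) ∈ PosCone n S}

/-- Automorphy factor attached to a vector:
`j(g,z) = -γ Q₀(z) + (d,z)₀ + δ` for `g = (δ,dᵀ,γ)ᵀ`. -/
noncomputable def jay (g : Fin (n + 4) → ℚ) (z : Fin (n + 2) → ℂ) : ℂ :=
  -((vlast g : ℚ) : ℂ) * quadF ℂ (MatS0 n S) z
    + bilin ℂ (MatS0 n S) (fun i => ((vmid g i : ℚ) : ℂ)) z
    + ((vfirst g : ℚ) : ℂ)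

/-- The index set of the Eisenstein series attached to a cusp `c`:
`{g ∈ L₁ + c : Q₁(g) = 0, gcd(S₁g) = 1}`. -/
def cuspSet (c : Fin (n + 4) → ℚ) : Set (Fin (n + 4) → ℚ) :=
  {g | inLatShift c g ∧ quadF ℚ (MatS1 n S) g = 0 ∧
    ratGcd (((MatS1 n S).map (Int.cast : ℤ → ℚ)).mulVec g) = 1}

/-- The standard-form cusp vector `(1, 0, 𝔠ᵀ, 0, Q(𝔠))ᵀ`. -/
def stdCuspVec (fc : Fin n → ℚ) : Fin (n + 4) → ℚ := fun i =>
  if h0 : (i : ℕ) = 0 then 1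
  else if h3 : (i : ℕ) = n + 3 then quadF ℚ S fc
  else if h12 : (i : ℕ) = 1 ∨ (i : ℕ) = n + 2 then 0
  else fc ⟨(i : ℕ) - 2, by have := i.isLt; omega⟩

/-- `c` is a standard-form cusp. -/
def IsStdCusp (c : Fin (n + 4) → ℚ) : Prop :=
  ∃ fc : Fin n → ℚ, inDual S fc ∧ (∃ z : ℤ, quadF ℚ S fc = (z : ℚ)) ∧
    c = stdCuspVec n S fc

/-- The real orthogonal group of `A`. -/
def OSet {m : ℕ} (A : Matrix (Fin m) (Fin m) ℤ) : Set (Matrix (Fin m) (Fin m) ℝ) :=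
  {M | Mᵀ * A.map (Int.cast : ℤ → ℝ) * M = A.map (Int.cast : ℤ → ℝ)}

/-- Connected component of the identity in the real orthogonal group. -/
def OPlus {m : ℕ} (A : Matrix (Fin m) (Fin m) ℤ) : Set (Matrix (Fin m) (Fin m) ℝ) :=
  connectedComponentIn (OSet A) 1

/-- `Γ_S`: integral matrices in `O⁺(S₁;ℝ)`. -/
def GammaS : Set (Matrix (Fin (n + 4)) (Fin (n + 4)) ℝ) :=
  {M | M ∈ OPlus (MatS1 n S) ∧ ∀ i j, ∃ z : ℤ, M i j = (z : ℝ)}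

/-- The discriminant kernel `Γ̃_S`. -/
def GammaTilde : Set (Matrix (Fin (n + 4)) (Fin (n + 4)) ℝ) :=
  {M | M ∈ GammaS n S ∧
    ∃ X : Matrix (Fin (n + 4)) (Fin (n + 4)) ℤ,
      M = 1 + (X * MatS1 n S).map (Int.cast : ℤ → ℝ)}

/-- Automorphy factor of a matrix: `j(M,z) = -γ Q₀(z) + (d,z)₀ + δ`
where `(γ, dᵀS₀, δ)` is the bottom row of `M`. -/
noncomputable def jayM (M : Matrix (Fin (n + 4)) (Fin (n + 4)) ℝ)
    (z : Fin (n + 2) → ℂ) : ℂ :=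
  -((M ⟨n + 3, by omega⟩ ⟨0, by omega⟩ : ℝ) : ℂ) * quadF ℂ (MatS0 n S) z
    + ∑ i : Fin (n + 2),
        ((M ⟨n + 3, by omega⟩ ⟨(i : ℕ) + 1, by have := i.isLt; omega⟩ : ℝ) : ℂ) * z i
    + ((M ⟨n + 3, by omega⟩ ⟨n + 3, by omega⟩ : ℝ) : ℂ)

/-- The action `M⟨z⟩ = (-Q₀(z)·b + Kz + c')·j(M,z)⁻¹`. -/
noncomputable def actM (M : Matrix (Fin (n + 4)) (Fin (n + 4)) ℝ)
    (z : Fin (n + 2) → ℂ) : Fin (n + 2) → ℂ := fun i =>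
  (-(quadF ℂ (MatS0 n S) z) *
      ((M ⟨(i : ℕ) + 1, by have := i.isLt; omega⟩ ⟨0, by omega⟩ : ℝ) : ℂ)
    + ∑ j : Fin (n + 2),
        ((M ⟨(i : ℕ) + 1, by have := i.isLt; omega⟩
            ⟨(j : ℕ) + 1, by have := j.isLt; omega⟩ : ℝ) : ℂ) * z j
    + ((M ⟨(i : ℕ) + 1, by have := i.isLt; omega⟩ ⟨n + 3, by omega⟩ : ℝ) : ℂ))
  * (jayM n S M z)⁻¹

/-- The integral vector `(−Q₀(d)/γ, dᵀ, γ)ᵀ` built from `d` and `γ`. -/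
def gExt (d : Fin (n + 2) → ℕ) (γ : ℕ) : Fin (n + 4) → ℚ := fun i =>
  if h0 : (i : ℕ) = 0 then -(quadF ℚ (MatS0 n S) fun j => (d j : ℚ)) / γ
  else if h3 : (i : ℕ) = n + 3 then (γ : ℚ)
  else (d ⟨(i : ℕ) - 1, by have := i.isLt; omega⟩ : ℚ)

open scoped Classical in
/-- The Dirichlet coefficient `a(λ,γ)`. -/
noncomputable def aCoef (lam : Fin (n + 2) → ℚ) (γ : ℕ) : ℂ :=
  ∑ d ∈ Fintype.piFinset fun _ : Fin (n + 2) => Finset.range γ,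
    if (∃ e : ℤ, quadF ℚ (MatS0 n S) (fun j => (d j : ℚ)) = (γ : ℚ) * e) ∧
        ratGcd (((MatS1 n S).map (Int.cast : ℤ → ℚ)).mulVec (gExt n S d γ)) = 1 then
      Complex.exp (2 * Real.pi * Complex.I *
        ((bilin ℚ (MatS0 n S) lam (fun j => (d j : ℚ)) / γ : ℚ) : ℂ))
    else 0

/-- The convolution `b(λ,γ) = Σ_{δ∣γ} a(λ,δ)`. -/
noncomputable def bCoef (lam : Fin (n + 2) → ℚ) (γ : ℕ) : ℂ :=
  ∑ δ ∈ γ.divisors, aCoef n S lam δ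

/-- The order/level of a rational vector: least `N ≥ 1` with `Nv` integral. -/
noncomputable def ordv {m : ℕ} (v : Fin m → ℚ) : ℕ :=
  sInf {N : ℕ | 0 < N ∧ ∀ i, ∃ z : ℤ, (N : ℚ) * v i = (z : ℚ)}

/-- `S` is `p`-maximal. -/
def pMaximal (p : ℕ) : Prop :=
  ∀ v : Fin n → ℚ, inDual S v → (∃ z : ℤ, quadF ℚ S v = (z : ℚ)) → ¬ p ∣ ordv v

/-- The vector `(l, μᵀ, m)ᵀ ∈ ℚ^{n+2}`. -/
def asmVec (l : ℚ) (μ : Fin n → ℚ) (m : ℚ) : Fin (n + 2) → ℚ := fun i =>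
  if h0 : (i : ℕ) = 0 then l
  else if h1 : (i : ℕ) = n + 1 then m
  else μ ⟨(i : ℕ) - 1, by have := i.isLt; omega⟩

open scoped Classical in
/-- The representation number `N(λ, p^ν, p^t)`. -/
noncomputable def Ncount (lam : Fin (n + 2) → ℚ) (p νl ν t : ℕ) : ℕ :=
  ((Fintype.piFinset fun _ : Fin n => Finset.range (p ^ ν)).filter fun v =>
    (∃ e : ℤ, quadF ℚ S (fun i => (v i : ℚ)) = (p : ℚ) ^ (t : ℕ) * e) ∧
    (∃ e : ℤ, (p : ℚ) ^ ((νl : ℤ) - (t : ℤ)) * quadF ℚ S (fun i => (v i : ℚ))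
        - bilin ℚ S (fun i => (v i : ℚ)) (vmid lam)
        + (p : ℚ) ^ ((t : ℤ) - (νl : ℤ)) * lam ⟨0, by omega⟩ * lam ⟨n + 1, by omega⟩
      = (p : ℚ) ^ (ν : ℕ) * e)).card

/-- `N*(λ,p^ν) = Σ_{t=0}^{min(ν,ν_λ)} N(λ,p^ν,p^t)`. -/
noncomputable def Nstar (lam : Fin (n + 2) → ℚ) (p νl ν : ℕ) : ℕ :=
  ∑ t ∈ Finset.range (min ν νl + 1), Ncount n S lam p νl ν t

/-- Kloosterman sum `K(α,β;γ)` (with `β` allowed rational;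
in all uses `β` is an integer). -/
noncomputable def kloos (α : ℤ) (β : ℚ) (γ : ℕ) : ℂ :=
  ∑ j ∈ Finset.range γ,
    if Nat.Coprime j γ then
      Complex.exp (2 * Real.pi * Complex.I *
        ((((α : ℚ) * j + β * ((((j : ZMod γ)⁻¹).val : ℕ) : ℚ)) / γ : ℚ) : ℂ))
    else 0

/-- `q ≡ 0 (mod p^k)` in `ℤ_p`, for a rational `q`. -/
def pCong (p k : ℕ) (q : ℚ) : Prop :=
  q = 0 ∨ (k : ℤ) ≤ padicValRat p q

/-- The constant `c_{k,S}^• = (2π)^{2k-n/2}/(√(det S)·Γ(k)·Γ(k-n/2))`. -/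
noncomputable def ckS (k : ℕ) : ℝ :=
  (2 * Real.pi) ^ ((2 * k : ℝ) - n / 2) /
    (Real.sqrt ((S.det : ℤ) : ℝ) * Real.Gamma (k : ℝ) * Real.Gamma ((k : ℝ) - n / 2))

end OEis

namespace OEis

section Hyp

variable {m : ℕ} {K : Type*} [CommRing K] (A : Matrix (Fin m) (Fin m) ℤ)

theorem hyp_map_mulVec_zero (g : Fin (m + 2) → K) :
    ((hyp A).map (Int.cast : ℤ → K) *ᵥ g) 0 = g (Fin.last (m + 1)) := by
  rw [Matrix.mulVec, dotProduct, Fin.sum_univ_castSucc, Fin.sum_univ_succ]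
  have h (x : Fin m) : (x : ℕ) ≠ m := by omega
  simp [hyp, h]

theorem hyp_map_mulVec_last (g : Fin (m + 2) → K) :
    ((hyp A).map (Int.cast : ℤ → K) *ᵥ g) (Fin.last (m + 1)) = g 0 := by
  rw [Matrix.mulVec, dotProduct, Fin.sum_univ_castSucc, Fin.sum_univ_succ]
  simp [hyp]

theorem hyp_map_mulVec_mid (g : Fin (m + 2) → K) (i : Fin m) :
    ((hyp A).map (Int.cast : ℤ → K) *ᵥ g) i.succ.castSucc =
      (A.map (Int.cast : ℤ → K) *ᵥ fun j => g j.succ.castSucc) i := by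
  rw [Matrix.mulVec, dotProduct, Fin.sum_univ_castSucc, Fin.sum_univ_succ]
  have h (x : Fin m) : (x : ℕ) ≠ m := by omega
  simp [hyp, h, Matrix.mulVec, dotProduct]

theorem forall_fin_add_two {P : Fin (m + 2) → Prop} :
    (∀ i, P i) ↔ P 0 ∧ (∀ i : Fin m, P i.succ.castSucc) ∧ P (Fin.last (m + 1)) := by
  rw [Fin.forall_fin_succ', Fin.forall_fin_succ, and_assoc]
  rfl

theorem hyp_isSymm (hA : A.IsSymm) : (hyp A).IsSymm := by
  ext i j
  simp only [transpose_apply, hyp]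
  split_ifs <;> first | rfl | omega | exact hA.apply _ _

theorem two_dvd_dotProduct_hyp_mulVec (hA : ∀ v : Fin m → ℤ, 2 ∣ v ⬝ᵥ A *ᵥ v)
    (v : Fin (m + 2) → ℤ) : 2 ∣ v ⬝ᵥ hyp A *ᵥ v := by
  have hz := hyp_map_mulVec_zero A v
  have hl := hyp_map_mulVec_last A v
  have hm := hyp_map_mulVec_mid A v
  have hid {k : ℕ} (B : Matrix (Fin k) (Fin k) ℤ) : B.map (Int.cast : ℤ → ℤ) = B := by
    ext; simp
  rw [hid] at hz hl hm
  obtain ⟨c, hc⟩ := hA fun j => v j.succ.castSucc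
  refine ⟨v 0 * v (Fin.last (m + 1)) + c, ?_⟩
  rw [mul_add, ← hc, dotProduct, Fin.sum_univ_castSucc, Fin.sum_univ_succ]
  simp only [Fin.castSucc_zero, hz, hl, hm, hid, dotProduct]
  ring

end Hyp

theorem ratGcd_eq_one_iff {m : ℕ} (v : Fin m → ℚ) :
    ratGcd v = 1 ↔ ∀ p : ℕ, p.Prime → ¬ ∀ i, (p : ℤ) ∣ (v i).num := by
  rw [ratGcd, Nat.eq_one_iff_not_exists_prime_dvd]
  simp only [Finset.dvd_gcd_iff, Finset.mem_univ, forall_const, Int.natCast_dvd]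

section Form

variable {m : ℕ} (A : Matrix (Fin m) (Fin m) ℤ)

/-- The integral quadratic form `vᵀAv/2` of an even matrix `A`. -/
def intForm (v : Fin m → ℤ) : ℤ := (v ⬝ᵥ A *ᵥ v) / 2

/-- The condition on the summation vectors of the Dirichlet coefficients, one prime at a time:
`γ ∣ q(d)` and `γ`, `A d`, `q(d)/γ` have no common prime factor. -/
def IsPrimitiveZero (γ : ℕ) (d : Fin m → ℤ) : Prop :=
  ∃ e : ℤ, intForm A d = γ * e ∧
    ∀ p : ℕ, p.Prime → p ∣ γ → (∀ i, (p : ℤ) ∣ (A *ᵥ d) i) → ¬ (p : ℤ) ∣ e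

variable {A}

theorem two_mul_intForm (hA : ∀ v : Fin m → ℤ, 2 ∣ v ⬝ᵥ A *ᵥ v) (v : Fin m → ℤ) :
    2 * intForm A v = v ⬝ᵥ A *ᵥ v :=
  Int.mul_ediv_cancel' (hA v)

theorem dotProduct_mulVec_comm_of_isSymm (hs : A.IsSymm) (x y : Fin m → ℤ) :
    x ⬝ᵥ A *ᵥ y = y ⬝ᵥ A *ᵥ x := by
  rw [dotProduct_mulVec, ← mulVec_transpose, hs.eq, dotProduct_comm]

theorem intForm_smul_add_smul (hs : A.IsSymm) (hA : ∀ v : Fin m → ℤ, 2 ∣ v ⬝ᵥ A *ᵥ v)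
    (a b : ℤ) (x y : Fin m → ℤ) :
    intForm A (a • x + b • y) =
      a ^ 2 * intForm A x + a * b * (x ⬝ᵥ A *ᵥ y) + b ^ 2 * intForm A y := by
  have h := two_mul_intForm hA (a • x + b • y)
  simp only [mulVec_add, mulVec_smul, dotProduct_add, add_dotProduct, dotProduct_smul,
    smul_dotProduct, smul_eq_mul, ← two_mul_intForm hA x, ← two_mul_intForm hA y,
    dotProduct_mulVec_comm_of_isSymm hs y x] at h
  linarith

theorem dvd_dotProduct_mulVec {p : ℤ} {x y : Fin m → ℤ} (hy : ∀ i, p ∣ (A *ᵥ y) i) :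
    p ∣ x ⬝ᵥ A *ᵥ y :=
  Finset.dvd_sum fun i _ => (hy i).mul_left _

theorem IsPrimitiveZero.add_smul (hs : A.IsSymm) (hA : ∀ v : Fin m → ℤ, 2 ∣ v ⬝ᵥ A *ᵥ v)
    {γ : ℕ} {d : Fin m → ℤ} (h : IsPrimitiveZero A γ d) (x : Fin m → ℤ) :
    IsPrimitiveZero A γ (d + (γ : ℤ) • x) := by
  obtain ⟨e, he, hp⟩ := h
  refine ⟨e + d ⬝ᵥ A *ᵥ x + γ * intForm A x, ?_, fun p hpp hpγ hpA hpe => ?_⟩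
  · have := intForm_smul_add_smul hs hA 1 γ d x
    rw [one_smul] at this
    rw [this, he]
    ring
  · have hpγ' : (p : ℤ) ∣ γ := Int.natCast_dvd_natCast.2 hpγ
    have hd : ∀ i, (p : ℤ) ∣ (A *ᵥ d) i := fun i => by
      have := hpA i
      rw [mulVec_add, mulVec_smul, Pi.add_apply, Pi.smul_apply, smul_eq_mul] at this
      exact (dvd_add_left (hpγ'.mul_right _)).1 this
    refine hp p hpp hpγ hd ?_
    rw [dvd_add_left (hpγ'.mul_right _), dotProduct_mulVec_comm_of_isSymm hs] at hpe
    exact (dvd_add_left (dvd_dotProduct_mulVec hd)).1 hpe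

theorem isPrimitiveZero_add_smul_iff (hs : A.IsSymm)
    (hA : ∀ v : Fin m → ℤ, 2 ∣ v ⬝ᵥ A *ᵥ v) (γ : ℕ) (d x : Fin m → ℤ) :
    IsPrimitiveZero A γ (d + (γ : ℤ) • x) ↔ IsPrimitiveZero A γ d := by
  refine ⟨fun h => ?_, fun h => h.add_smul hs hA x⟩
  simpa [add_assoc] using h.add_smul hs hA (-x)

theorem IsPrimitiveZero.of_mul (hs : A.IsSymm) (hA : ∀ v : Fin m → ℤ, 2 ∣ v ⬝ᵥ A *ᵥ v)
    {γ γ' : ℕ} (hγ : 0 < γ) (hγ' : 0 < γ') (hco : γ.Coprime γ') {x y : Fin m → ℤ}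
    (h : IsPrimitiveZero A (γ * γ') ((γ' : ℤ) • x + (γ : ℤ) • y)) :
    IsPrimitiveZero A γ x := by
  obtain ⟨e, he, hp⟩ := h
  rw [intForm_smul_add_smul hs hA] at he
  push_cast at he
  have hcoZ : IsCoprime (γ : ℤ) (γ' : ℤ) := hco.isCoprime
  have hx : (γ : ℤ) ∣ intForm A x := by
    refine (hcoZ.pow_right (n := 2)).dvd_of_dvd_mul_left
      ⟨γ' * e - γ' * (x ⬝ᵥ A *ᵥ y) - γ * intForm A y, ?_⟩
    linear_combination he
  have hy : (γ' : ℤ) ∣ intForm A y := by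
    refine (hcoZ.symm.pow_right (n := 2)).dvd_of_dvd_mul_left
      ⟨γ * e - γ * (x ⬝ᵥ A *ᵥ y) - γ' * intForm A x, ?_⟩
    linear_combination he
  obtain ⟨f, hf⟩ := hx
  obtain ⟨g, hg⟩ := hy
  have hef : e = γ' * f + x ⬝ᵥ A *ᵥ y + γ * g := by
    have h0 : ((γ : ℤ) * γ') ≠ 0 := by positivity
    apply mul_left_cancel₀ h0
    rw [hf, hg] at he
    linear_combination -he
  refine ⟨f, hf, fun p hpp hpγ hpA hpf => ?_⟩
  have hpγZ : (p : ℤ) ∣ γ := Int.natCast_dvd_natCast.2 hpγ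
  refine hp p hpp (hpγ.mul_right _) (fun i => ?_) ?_
  · rw [mulVec_add, mulVec_smul, mulVec_smul]
    exact dvd_add ((hpA i).mul_left _) (hpγZ.mul_right _)
  · rw [hef, dotProduct_mulVec_comm_of_isSymm hs]
    exact dvd_add (dvd_add (hpf.mul_left _) (dvd_dotProduct_mulVec hpA)) (hpγZ.mul_right _)

theorem isPrimitiveZero_mul_iff (hs : A.IsSymm) (hA : ∀ v : Fin m → ℤ, 2 ∣ v ⬝ᵥ A *ᵥ v)
    {γ γ' : ℕ} (hγ : 0 < γ) (hγ' : 0 < γ') (hco : γ.Coprime γ') (x y : Fin m → ℤ) :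
    IsPrimitiveZero A (γ * γ') ((γ' : ℤ) • x + (γ : ℤ) • y) ↔
      IsPrimitiveZero A γ x ∧ IsPrimitiveZero A γ' y := by
  refine ⟨fun h => ⟨h.of_mul hs hA hγ hγ' hco, ?_⟩, ?_⟩
  · rw [mul_comm, add_comm] at h
    exact h.of_mul hs hA hγ' hγ hco.symm
  rintro ⟨⟨f, hf, hp⟩, ⟨g, hg, hq⟩⟩
  refine ⟨γ' * f + x ⬝ᵥ A *ᵥ y + γ * g, ?_, fun p hpp hpγ hpA hpe => ?_⟩
  · rw [intForm_smul_add_smul hs hA, hf, hg]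
    push_cast
    ring
  have hpZ : Prime (p : ℤ) := Nat.prime_iff_prime_int.1 hpp
  have hpA' : ∀ i, (p : ℤ) ∣ γ' * (A *ᵥ x) i + γ * (A *ᵥ y) i := fun i => by
    simpa only [mulVec_add, mulVec_smul, Pi.add_apply, Pi.smul_apply, smul_eq_mul] using hpA i
  rcases hpp.dvd_mul.1 hpγ with h | h
  · have hZ : (p : ℤ) ∣ γ := Int.natCast_dvd_natCast.2 h
    have hn : ¬ (p : ℤ) ∣ γ' := fun h' =>
      Nat.not_coprime_of_dvd_of_dvd hpp.one_lt h (Int.natCast_dvd_natCast.1 h') hco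
    have hx : ∀ i, (p : ℤ) ∣ (A *ᵥ x) i := fun i =>
      (hpZ.dvd_or_dvd ((dvd_add_left (hZ.mul_right _)).1 (hpA' i))).resolve_left hn
    refine hp p hpp h hx ?_
    rw [dvd_add_left (hZ.mul_right _), dotProduct_mulVec_comm_of_isSymm hs,
      dvd_add_left (dvd_dotProduct_mulVec hx)] at hpe
    exact (hpZ.dvd_or_dvd hpe).resolve_left hn
  · have hZ : (p : ℤ) ∣ γ' := Int.natCast_dvd_natCast.2 h
    have hn : ¬ (p : ℤ) ∣ γ := fun h' =>
      Nat.not_coprime_of_dvd_of_dvd hpp.one_lt (Int.natCast_dvd_natCast.1 h') h hco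
    have hy : ∀ i, (p : ℤ) ∣ (A *ᵥ y) i := fun i =>
      (hpZ.dvd_or_dvd ((dvd_add_right (hZ.mul_right _)).1 (hpA' i))).resolve_left hn
    refine hq p hpp h hy ?_
    rw [add_assoc, dvd_add_right (hZ.mul_right _),
      dvd_add_right (dvd_dotProduct_mulVec hy)] at hpe
    exact (hpZ.dvd_or_dvd hpe).resolve_left hn

end Form

section Summand

variable {m : ℕ} (A : Matrix (Fin m) (Fin m) ℤ) (lam : Fin m → ℚ)

/-- The rational number `(λ, d)` for an integral vector `d`. -/
def pairing (d : Fin m → ℤ) : ℚ := bilin ℚ A lam fun j => (d j : ℚ)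

open scoped Classical in
/-- The summand of the Dirichlet coefficient, extended to all integral vectors. -/
noncomputable def summand (γ : ℕ) (d : Fin m → ℤ) : ℂ :=
  if IsPrimitiveZero A γ d then
    Complex.exp (2 * Real.pi * Complex.I * ((pairing A lam d / γ : ℚ) : ℂ))
  else 0

theorem pairing_smul_add_smul (a b : ℤ) (x y : Fin m → ℤ) :
    pairing A lam (a • x + b • y) = a * pairing A lam x + b * pairing A lam y := by
  have h : (fun j => (((a • x + b • y) j : ℤ) : ℚ)) =
      (a : ℚ) • (fun j => (x j : ℚ)) + (b : ℚ) • (fun j => (y j : ℚ)) := by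
    ext j
    simp
  simp only [pairing, bilin, h, mulVec_add, mulVec_smul, dotProduct_add, dotProduct_smul,
    smul_eq_mul]

variable {A lam}

theorem exists_int_pairing_eq (hs : A.IsSymm) (hlam : inDual A lam) (d : Fin m → ℤ) :
    ∃ z : ℤ, pairing A lam d = z := by
  choose z hz using hlam
  refine ⟨d ⬝ᵥ z, ?_⟩
  rw [pairing, bilin, dotProduct_mulVec, ← mulVec_transpose, (hs.map _).eq, dotProduct_comm]
  simp [dotProduct, hz]

theorem summand_add_smul (hs : A.IsSymm) (hA : ∀ v : Fin m → ℤ, 2 ∣ v ⬝ᵥ A *ᵥ v)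
    (hlam : inDual A lam) {γ : ℕ} (hγ : 0 < γ) (d x : Fin m → ℤ) :
    summand A lam γ (d + (γ : ℤ) • x) = summand A lam γ d := by
  classical
  refine if_congr (isPrimitiveZero_add_smul_iff hs hA γ d x) ?_ rfl
  obtain ⟨z, hz⟩ := exists_int_pairing_eq hs hlam x
  have h := pairing_smul_add_smul A lam 1 γ d x
  rw [one_smul] at h
  rw [h, hz, Complex.exp_eq_exp_iff_exists_int]
  refine ⟨z, ?_⟩
  have : (γ : ℂ) ≠ 0 := by exact_mod_cast hγ.ne'
  push_cast
  field_simp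

theorem summand_mul (hs : A.IsSymm) (hA : ∀ v : Fin m → ℤ, 2 ∣ v ⬝ᵥ A *ᵥ v)
    {γ γ' : ℕ} (hγ : 0 < γ) (hγ' : 0 < γ') (hco : γ.Coprime γ') (x y : Fin m → ℤ) :
    summand A lam (γ * γ') ((γ' : ℤ) • x + (γ : ℤ) • y) =
      summand A lam γ x * summand A lam γ' y := by
  unfold summand
  rw [ite_zero_mul_ite_zero]
  classical
  refine if_congr (isPrimitiveZero_mul_iff hs hA hγ hγ' hco x y) ?_ rfl
  rw [pairing_smul_add_smul, ← Complex.exp_add]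
  congr 1
  have h : (γ : ℂ) ≠ 0 := by exact_mod_cast hγ.ne'
  have h' : (γ' : ℂ) ≠ 0 := by exact_mod_cast hγ'.ne'
  push_cast
  field_simp

/-- The vector of remainders modulo `γγ'` of `γ'x + γy`. -/
def crtVec (γ γ' : ℕ) (p : (Fin m → ℕ) × (Fin m → ℕ)) : Fin m → ℕ :=
  fun i => (γ' * p.1 i + γ * p.2 i) % (γ * γ')

theorem eq_of_crt_modEq {γ γ' a b c d : ℕ} (hco : γ.Coprime γ') (ha : a < γ) (hc : c < γ)
    (h : γ' * a + γ * b ≡ γ' * c + γ * d [MOD γ * γ']) : a = c := by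
  have h1 : γ' * a + γ * b ≡ γ' * c + γ * d [MOD γ] := h.of_mul_right γ'
  have h2 : γ' * a ≡ γ' * c [MOD γ] := by
    simpa [Nat.ModEq, Nat.add_mul_mod_self_left] using h1
  exact (Nat.ModEq.cancel_left_of_coprime hco h2).eq_of_lt_of_lt ha hc

theorem crtVec_injOn {γ γ' : ℕ} (hco : γ.Coprime γ') :
    Set.InjOn (crtVec (m := m) γ γ')
      ((Fintype.piFinset fun _ : Fin m => Finset.range γ) ×ˢ
        Fintype.piFinset fun _ : Fin m => Finset.range γ' :
          Finset ((Fin m → ℕ) × (Fin m → ℕ))) := by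
  rintro ⟨x, y⟩ hxy ⟨x', y'⟩ hxy' h
  simp only [Finset.coe_product, Set.mem_prod, Finset.mem_coe, Fintype.mem_piFinset,
    Finset.mem_range] at hxy hxy'
  have hi (i : Fin m) : γ' * x i + γ * y i ≡ γ' * x' i + γ * y' i [MOD γ * γ'] := congrFun h i
  refine Prod.ext (funext fun i => ?_) (funext fun i => ?_)
  · exact eq_of_crt_modEq hco (hxy.1 i) (hxy'.1 i) (hi i)
  · refine eq_of_crt_modEq (b := x i) (d := x' i) hco.symm (hxy.2 i) (hxy'.2 i) ?_
    have := hi i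
    rwa [add_comm, add_comm (γ' * x' i), mul_comm γ γ'] at this

theorem image_crtVec {γ γ' : ℕ} (hγ : 0 < γ) (hγ' : 0 < γ') (hco : γ.Coprime γ') :
    ((Fintype.piFinset fun _ : Fin m => Finset.range γ) ×ˢ
        Fintype.piFinset fun _ : Fin m => Finset.range γ').image (crtVec γ γ') =
      Fintype.piFinset fun _ : Fin m => Finset.range (γ * γ') := by
  refine Finset.eq_of_subset_of_card_le ?_ ?_
  · intro d hd
    obtain ⟨p, -, rfl⟩ := Finset.mem_image.1 hd
    simp only [Fintype.mem_piFinset, Finset.mem_range]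
    exact fun i => Nat.mod_lt _ (Nat.mul_pos hγ hγ')
  · rw [Finset.card_image_of_injOn (crtVec_injOn hco)]
    simp [mul_pow]

theorem sum_summand_mul (hs : A.IsSymm) (hA : ∀ v : Fin m → ℤ, 2 ∣ v ⬝ᵥ A *ᵥ v)
    (hlam : inDual A lam) {γ γ' : ℕ} (hγ : 0 < γ) (hγ' : 0 < γ') (hco : γ.Coprime γ') :
    ∑ d ∈ Fintype.piFinset fun _ : Fin m => Finset.range (γ * γ'),
        summand A lam (γ * γ') (fun j => (d j : ℤ)) =
      (∑ d ∈ Fintype.piFinset fun _ : Fin m => Finset.range γ,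
          summand A lam γ (fun j => (d j : ℤ))) *
        ∑ d ∈ Fintype.piFinset fun _ : Fin m => Finset.range γ',
          summand A lam γ' (fun j => (d j : ℤ)) := by
  rw [← image_crtVec hγ hγ' hco, Finset.sum_image (crtVec_injOn hco), Finset.sum_mul_sum,
    ← Finset.sum_product']
  refine Finset.sum_congr rfl fun p _ => ?_
  rw [← summand_mul hs hA hγ hγ' hco,
    ← summand_add_smul hs hA hlam (Nat.mul_pos hγ hγ') (fun j => (crtVec γ γ' p j : ℤ))
      fun j => (((γ' * p.1 j + γ * p.2 j) / (γ * γ') : ℕ) : ℤ)]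
  congr 1
  ext j
  simp only [Pi.add_apply, Pi.smul_apply, smul_eq_mul, crtVec]
  exact_mod_cast Nat.mod_add_div _ _

end Summand

section Coefficient

variable {n : ℕ} {S : Matrix (Fin n) (Fin n) ℤ}

theorem two_dvd_dotProduct_MatS0_mulVec (heven : ∀ v : Fin n → ℤ, 2 ∣ v ⬝ᵥ S *ᵥ v)
    (v : Fin (n + 2) → ℤ) : 2 ∣ v ⬝ᵥ MatS0 n S *ᵥ v :=
  two_dvd_dotProduct_hyp_mulVec _ (fun w => by
    simpa only [neg_mulVec, dotProduct_neg, dvd_neg] using heven w) v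

theorem map_intCast_mulVec {m : ℕ} (A : Matrix (Fin m) (Fin m) ℤ) (d : Fin m → ℤ) (i : Fin m) :
    (A.map (Int.cast : ℤ → ℚ) *ᵥ fun j => (d j : ℚ)) i = ((A *ᵥ d) i : ℤ) := by
  simp [mulVec, dotProduct]

theorem quadF_intCast {m : ℕ} {A : Matrix (Fin m) (Fin m) ℤ}
    (hA : ∀ v : Fin m → ℤ, 2 ∣ v ⬝ᵥ A *ᵥ v) (d : Fin m → ℤ) :
    quadF ℚ A (fun j => (d j : ℚ)) = intForm A d := by
  have h : bilin ℚ A (fun j => (d j : ℚ)) (fun j => (d j : ℚ)) = ((d ⬝ᵥ A *ᵥ d : ℤ) : ℚ) := by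
    simp only [bilin, dotProduct, map_intCast_mulVec]
    push_cast
    rfl
  rw [quadF, h, ← two_mul_intForm hA]
  push_cast
  ring

theorem isPrimitiveZero_iff_ratGcd (heven : ∀ v : Fin n → ℤ, 2 ∣ v ⬝ᵥ S *ᵥ v)
    {γ : ℕ} (hγ : 0 < γ) (d : Fin (n + 2) → ℕ) :
    IsPrimitiveZero (MatS0 n S) γ (fun j => (d j : ℤ)) ↔
      (∃ e : ℤ, quadF ℚ (MatS0 n S) (fun j => (d j : ℚ)) = (γ : ℚ) * e) ∧
        ratGcd (((MatS1 n S).map (Int.cast : ℤ → ℚ)).mulVec (gExt n S d γ)) = 1 := by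
  have hq := quadF_intCast (two_dvd_dotProduct_MatS0_mulVec heven) (fun j => (d j : ℤ))
  simp only [Int.cast_natCast] at hq
  have hγQ : (γ : ℚ) ≠ 0 := by exact_mod_cast hγ.ne'
  have key (e : ℤ) (he : intForm (MatS0 n S) (fun j => (d j : ℤ)) = γ * e) :
      ratGcd (((MatS1 n S).map (Int.cast : ℤ → ℚ)).mulVec (gExt n S d γ)) = 1 ↔
        ∀ p : ℕ, p.Prime → p ∣ γ → (∀ i, (p : ℤ) ∣ (MatS0 n S *ᵥ fun j => (d j : ℤ)) i) →
          ¬ (p : ℤ) ∣ e := by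
    have h0 : gExt n S d γ 0 = ((-e : ℤ) : ℚ) := by
      simp only [gExt, Fin.val_zero, dite_true, hq, he]
      push_cast
      field_simp
    have hl : gExt n S d γ (Fin.last (n + 3)) = ((γ : ℤ) : ℚ) := by
      simp [gExt]
    have hm (j : Fin (n + 2)) : gExt n S d γ j.succ.castSucc = ((d j : ℤ) : ℚ) := by
      have : (j : ℕ) ≠ n + 2 := by omega
      simp [gExt, this]
    have h0' := hyp_map_mulVec_zero (MatS0 n S) (gExt n S d γ)
    have hl' := hyp_map_mulVec_last (MatS0 n S) (gExt n S d γ)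
    have hm' := hyp_map_mulVec_mid (MatS0 n S) (gExt n S d γ)
    rw [hl] at h0'
    rw [h0] at hl'
    simp only [hm, map_intCast_mulVec] at hm'
    rw [ratGcd_eq_one_iff]
    refine forall₂_congr fun p _ => ?_
    rw [forall_fin_add_two, MatS1, h0', hl']
    simp only [hm', Rat.num_intCast, Int.natCast_dvd_natCast, dvd_neg, not_and]
  constructor
  · rintro ⟨e, he, hp⟩
    exact ⟨⟨e, by rw [hq, he]; push_cast; rfl⟩, (key e he).2 hp⟩
  · rintro ⟨⟨e, he⟩, hp⟩
    have he' : intForm (MatS0 n S) (fun j => (d j : ℤ)) = γ * e := by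
      rw [hq] at he
      exact_mod_cast he
    exact ⟨e, he', (key e he').1 hp⟩

theorem aCoef_eq_sum_summand (heven : ∀ v : Fin n → ℤ, 2 ∣ v ⬝ᵥ S *ᵥ v)
    (lam : Fin (n + 2) → ℚ) {γ : ℕ} (hγ : 0 < γ) :
    aCoef n S lam γ = ∑ d ∈ Fintype.piFinset fun _ : Fin (n + 2) => Finset.range γ,
      summand (MatS0 n S) lam γ (fun j => (d j : ℤ)) := by
  refine Finset.sum_congr rfl fun d _ => ?_
  classical
  refine if_congr (isPrimitiveZero_iff_ratGcd heven hγ d).symm ?_ rfl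
  simp only [pairing, Int.cast_natCast]

end Coefficient

end OEis

open OEis

/-- the Dirichlet coefficients `a(λ,·)` are multiplicative. -/
theorem dirichlet_coeff_multiplicative
    (n : ℕ) (hn : 1 ≤ n) (S : Matrix (Fin n) (Fin n) ℤ)
    (hsymm : S.IsSymm)
    (hpos : ∀ v : Fin n → ℝ, v ≠ 0 → 0 < bilin ℝ S v v)
    (heven : ∀ v : Fin n → ℤ, 2 ∣ v ⬝ᵥ S.mulVec v)
    (lam : Fin (n + 2) → ℚ) (hlam : inDual (MatS0 n S) lam)
    (γ γ' : ℕ) (hγ : 0 < γ) (hγ' : 0 < γ') (hco : Nat.Coprime γ γ') :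
    aCoef n S lam (γ * γ') = aCoef n S lam γ * aCoef n S lam γ' := by
  have hs : (MatS0 n S).IsSymm := hyp_isSymm _ hsymm.neg
  have hA := two_dvd_dotProduct_MatS0_mulVec heven
  rw [aCoef_eq_sum_summand heven lam (Nat.mul_pos hγ hγ'), aCoef_eq_sum_summand heven lam hγ,
    aCoef_eq_sum_summand heven lam hγ', sum_summand_mul hs hA hlam hγ hγ' hco]
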